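/- arXiv:1912.00990 — 2 statements merged into one kernel-verified Lean document; each statement's English description precedes it below -/
import Mathlib

section
/- (Jordan's lemma, Nagaj–Wocjan–Zhang form; the paper's Lemma 3.1.) Let Π₀ and Π₁ be orthogonal projections on an N-dimensional complex inner product space H, let R₀ = 2Π₀ − I, R₁ = 2Π₁ − I, and Q = R₁R₀. Then H is an orthogonal direct sum of two-dimensional subspaces S₁, …, S_ℓ and N − 2ℓ one-dimensional subspaces T_j^{(bc)} (b, c ∈ {0,1}) with the following properties: (1) each S_j admits two orthonormal bases (α_j, α_j^⊥) and (β_j, β_j^⊥) such that ⟨α_j, β_j⟩ is a positive real number, Π₀ s = ⟨α_j, s⟩ α_j and Π₁ s = ⟨β_j, s⟩ β_j for every s ∈ S_j, and S_j is invariant under Q, on which Q has the two eigenvalues e^{iθ_j} and e^{−iθ_j} with eigenvectors (α_j − i α_j^⊥)/√2 and (α_j + i α_j^⊥)/√2 respectively, where θ_j = 2 arccos ⟨α_j, β_j⟩; (2) each one-dimensional subspace T_j^{(bc)} is spanned by a vector v satisfying Π₀ v = b·v and Π₁ v = c·v. -/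
open scoped ComplexInnerProductSpace

section JordanDecomposition

variable {H : Type*} [NormedAddCommGroup H] [InnerProductSpace ℂ H]

/-- A two-dimensional subspace on which `P₀` and `P₁` restrict to the projections onto two lines
meeting at an angle strictly between `0` and `π / 2`, with cosine `x` and sine `y`. -/
def IsJordanBlock (P₀ P₁ : H →ₗ[ℂ] H) (S : Submodule ℂ H) : Prop :=
  ∃ (a a' : H) (x y : ℝ), 0 < x ∧ 0 < y ∧ x ^ 2 + y ^ 2 = 1 ∧
    ‖a‖ = 1 ∧ ‖a'‖ = 1 ∧ ⟪a, a'⟫ = 0 ∧ Submodule.span ℂ {a, a'} = S ∧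
    P₀ a = a ∧ P₀ a' = 0 ∧
    P₁ a = (x : ℂ) • ((x : ℂ) • a + (y : ℂ) • a') ∧
    P₁ a' = (y : ℂ) • ((x : ℂ) • a + (y : ℂ) • a')

/-- `W` is an orthogonal direct sum of Jordan blocks and of lines spanned by common eigenvectors
of `P₀` and `P₁`. -/
def HasJordanDecomposition (P₀ P₁ : H →ₗ[ℂ] H) (W : Submodule ℂ H) : Prop :=
  ∃ (ℓ r : ℕ) (S : Fin ℓ → Submodule ℂ H) (v : Fin r → H) (b c : Fin r → Bool),
    2 * ℓ + r = Module.finrank ℂ W ∧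
    (∀ j, IsJordanBlock P₀ P₁ (S j)) ∧
    Orthonormal ℂ v ∧
    (∀ j j', j ≠ j' → ∀ x ∈ S j, ∀ y ∈ S j', ⟪x, y⟫ = 0) ∧
    (∀ j i, ∀ x ∈ S j, ⟪x, v i⟫ = 0) ∧
    ((⨆ j, S j) ⊔ (⨆ i, Submodule.span ℂ {v i}) = W) ∧
    (∀ i, P₀ (v i) = (if b i then (1 : ℂ) else 0) • v i) ∧
    (∀ i, P₁ (v i) = (if c i then (1 : ℂ) else 0) • v i)

theorem inner_smul_add_smul_eq {a a' : H} (ha : ‖a‖ = 1) (ha' : ‖a'‖ = 1) (haa' : ⟪a, a'⟫ = 0)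
    (p q r s : ℂ) :
    ⟪p • a + q • a', r • a + s • a'⟫ = (starRingEnd ℂ) p * r + (starRingEnd ℂ) q * s := by
  have haa : ⟪a, a⟫ = 1 := by simp [inner_self_eq_norm_sq_to_K, ha]
  have ha'a' : ⟪a', a'⟫ = 1 := by simp [inner_self_eq_norm_sq_to_K, ha']
  have ha'a : ⟪a', a⟫ = 0 := inner_eq_zero_symm.1 haa'
  simp only [inner_add_left, inner_add_right, inner_smul_left, inner_smul_right, haa, ha'a', haa',
    ha'a]
  ring

theorem finrank_span_pair_of_orthonormal {a a' : H} (ha : ‖a‖ = 1) (ha' : ‖a'‖ = 1)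
    (haa' : ⟪a, a'⟫ = 0) : Module.finrank ℂ (Submodule.span ℂ {a, a'}) = 2 := by
  have ho : Orthonormal ℂ ![a, a'] := by
    rw [orthonormal_iff_ite]
    intro i j
    fin_cases i <;> fin_cases j <;>
      simp [inner_self_eq_norm_sq_to_K, ha, ha', haa', inner_eq_zero_symm.1 haa']
  rw [← Matrix.range_cons_cons_empty a a' ![], finrank_span_eq_card ho.linearIndependent,
    Fintype.card_fin]

namespace IsJordanBlock

variable {P₀ P₁ : H →ₗ[ℂ] H} {S : Submodule ℂ H}

theorem finrank_eq_two (h : IsJordanBlock P₀ P₁ S) : Module.finrank ℂ S = 2 := by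
  obtain ⟨a, a', x, y, -, -, -, ha, ha', haa', rfl, -⟩ := h
  exact finrank_span_pair_of_orthonormal ha ha' haa'

theorem apply_mem (h : IsJordanBlock P₀ P₁ S) : ∀ s ∈ S, P₀ s ∈ S ∧ P₁ s ∈ S := by
  obtain ⟨a, a', x, y, -, -, -, -, -, -, rfl, h₁, h₂, h₃, h₄⟩ := h
  intro s hs
  obtain ⟨p, q, rfl⟩ := Submodule.mem_span_pair.1 hs
  constructor
  · exact Submodule.mem_span_pair.2 ⟨p, 0, by simp [h₁, h₂]⟩
  · refine Submodule.mem_span_pair.2 ⟨p * x * x + q * y * x, p * x * y + q * y * y, ?_⟩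
    simp only [map_add, map_smul, h₃, h₄]
    module

theorem exists_bases (h : IsJordanBlock P₀ P₁ S) {R₀ R₁ Q : H →ₗ[ℂ] H}
    (hR₀ : R₀ = (2 : ℂ) • P₀ - LinearMap.id) (hR₁ : R₁ = (2 : ℂ) • P₁ - LinearMap.id)
    (hQ : Q = R₁ ∘ₗ R₀) :
    ∃ (a ap be bep : H) (θ : ℝ),
        a ∈ S ∧ ap ∈ S ∧ be ∈ S ∧ bep ∈ S ∧
        ‖a‖ = 1 ∧ ‖ap‖ = 1 ∧ ⟪a, ap⟫ = 0 ∧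
        ‖be‖ = 1 ∧ ‖bep‖ = 1 ∧ ⟪be, bep⟫ = 0 ∧
        Submodule.span ℂ ({a, ap} : Set H) = S ∧
        Submodule.span ℂ ({be, bep} : Set H) = S ∧
        (0 : ℝ) < (⟪a, be⟫).re ∧ (⟪a, be⟫).im = 0 ∧
        (∀ s ∈ S, P₀ s = ⟪a, s⟫ • a) ∧
        (∀ s ∈ S, P₁ s = ⟪be, s⟫ • be) ∧
        (∀ s ∈ S, Q s ∈ S) ∧
        θ = 2 * Real.arccos (⟪a, be⟫).re ∧
        Q ((Real.sqrt 2 : ℂ)⁻¹ • (a - Complex.I • ap)) =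
          Complex.exp ((θ : ℂ) * Complex.I) • ((Real.sqrt 2 : ℂ)⁻¹ • (a - Complex.I • ap)) ∧
        Q ((Real.sqrt 2 : ℂ)⁻¹ • (a + Complex.I • ap)) =
          Complex.exp (-(θ : ℂ) * Complex.I) • ((Real.sqrt 2 : ℂ)⁻¹ • (a + Complex.I • ap)) := by
  have hPS := h.apply_mem
  obtain ⟨a, a', x, y, hx, hy, hxy, ha, ha', haa', rfl, h₁, h₂, h₃, h₄⟩ := h
  have hxyC : (x : ℂ) ^ 2 + (y : ℂ) ^ 2 = 1 := by exact_mod_cast hxy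
  have key := inner_smul_add_smul_eq ha ha' haa'
  have hbe : ⟪a, (x : ℂ) • a + (y : ℂ) • a'⟫ = x := by simpa using key 1 0 x y
  have hnorm : ∀ p q : ℝ, p ^ 2 + q ^ 2 = 1 → ‖(p : ℂ) • a + (q : ℂ) • a'‖ = 1 := by
    intro p q hpq
    have h := key p q p q
    rw [inner_self_eq_norm_sq_to_K, Complex.conj_ofReal, Complex.conj_ofReal, ← sq, ← sq] at h
    have h' : ((‖(p : ℂ) • a + (q : ℂ) • a'‖ ^ 2 : ℝ) : ℂ) = (p ^ 2 + q ^ 2 : ℝ) := by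
      push_cast
      exact h
    rw [Complex.ofReal_inj, hpq] at h'
    exact (pow_eq_one_iff_of_nonneg (norm_nonneg _) two_ne_zero).1 h'
  have hQa : Q a = (2 * x ^ 2 - 1 : ℂ) • a + (2 * x * y : ℂ) • a' := by
    simp only [hQ, hR₀, hR₁, LinearMap.comp_apply, LinearMap.sub_apply, LinearMap.smul_apply,
      LinearMap.id_apply, h₁, map_sub, map_smul, h₃]
    module
  have hQa' : Q a' = (-(2 * x * y) : ℂ) • a + (2 * x ^ 2 - 1 : ℂ) • a' := by
    simp only [hQ, hR₀, hR₁, LinearMap.comp_apply, LinearMap.sub_apply, LinearMap.smul_apply,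
      LinearMap.id_apply, h₂, map_sub, map_smul, map_zero, h₄]
    rw [show (2 * x ^ 2 - 1 : ℂ) = 1 - 2 * y ^ 2 by linear_combination 2 * hxyC]
    module
  have hcos : Real.cos (2 * Real.arccos x) = 2 * x ^ 2 - 1 := by
    rw [Real.cos_two_mul, Real.cos_arccos (by linarith) (by nlinarith)]
  have hsin : Real.sin (2 * Real.arccos x) = 2 * x * y := by
    rw [Real.sin_two_mul, Real.cos_arccos (by linarith) (by nlinarith), Real.sin_arccos,
      show 1 - x ^ 2 = y ^ 2 by linarith, Real.sqrt_sq hy.le]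
    ring
  have hexp : Complex.exp ((2 * Real.arccos x : ℝ) * Complex.I) =
      (2 * x ^ 2 - 1) + (2 * x * y) * Complex.I := by
    rw [Complex.exp_mul_I, ← Complex.ofReal_cos, ← Complex.ofReal_sin, hcos, hsin]
    push_cast
    ring
  have hexp' : Complex.exp (-(2 * Real.arccos x : ℝ) * Complex.I) =
      (2 * x ^ 2 - 1) - (2 * x * y) * Complex.I := by
    rw [Complex.exp_mul_I, Complex.cos_neg, Complex.sin_neg, ← Complex.ofReal_cos,
      ← Complex.ofReal_sin, hcos, hsin]
    push_cast
    ring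
  refine ⟨a, a', (x : ℂ) • a + (y : ℂ) • a', (-y : ℂ) • a + (x : ℂ) • a', 2 * Real.arccos x,
    Submodule.subset_span (by simp), Submodule.subset_span (by simp),
    Submodule.mem_span_pair.2 ⟨_, _, rfl⟩, Submodule.mem_span_pair.2 ⟨_, _, rfl⟩, ha, ha', haa',
    hnorm x y hxy, by simpa using hnorm (-y) x (by linarith), ?_, rfl, ?_,
    by rwa [hbe, Complex.ofReal_re], by rw [hbe, Complex.ofReal_im], ?_, ?_, ?_,
    by rw [hbe, Complex.ofReal_re], ?_, ?_⟩
  · rw [key, Complex.conj_ofReal, Complex.conj_ofReal]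
    ring
  · apply le_antisymm <;> rw [Submodule.span_le, Set.pair_subset_iff]
    · exact ⟨Submodule.mem_span_pair.2 ⟨_, _, rfl⟩, Submodule.mem_span_pair.2 ⟨_, _, rfl⟩⟩
    · constructor
      · refine Submodule.mem_span_pair.2 ⟨x, -y, ?_⟩
        linear_combination (norm := module) hxyC • a
      · refine Submodule.mem_span_pair.2 ⟨y, x, ?_⟩
        linear_combination (norm := module) hxyC • a'
  · intro s hs
    obtain ⟨p, q, rfl⟩ := Submodule.mem_span_pair.1 hs
    have h : ⟪a, p • a + q • a'⟫ = p := by simpa using key 1 0 p q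
    simp [h, h₁, h₂]
  · intro s hs
    obtain ⟨p, q, rfl⟩ := Submodule.mem_span_pair.1 hs
    rw [key, Complex.conj_ofReal, Complex.conj_ofReal, map_add, map_smul, map_smul, h₃, h₄]
    module
  · intro s hs
    have hr : ∀ P : H →ₗ[ℂ] H, (∀ s ∈ Submodule.span ℂ {a, a'}, P s ∈ Submodule.span ℂ {a, a'}) →
        ∀ s ∈ Submodule.span ℂ {a, a'}, ((2 : ℂ) • P - LinearMap.id : H →ₗ[ℂ] H) s ∈
          Submodule.span ℂ {a, a'} :=
      fun P hP s hs => Submodule.sub_mem _ (Submodule.smul_mem _ _ (hP s hs)) hs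
    rw [hQ, hR₀, hR₁]
    exact hr P₁ (fun s hs => (hPS s hs).2) _ (hr P₀ (fun s hs => (hPS s hs).1) s hs)
  · rw [hexp, map_smul, map_sub, map_smul, hQa, hQa']
    match_scalars
    · ring
    · linear_combination (2 * (Real.sqrt 2 : ℂ)⁻¹ * x * y) * Complex.I_sq
  · rw [hexp', map_smul, map_add, map_smul, hQa, hQa']
    match_scalars
    · ring
    · linear_combination (2 * (Real.sqrt 2 : ℂ)⁻¹ * x * y) * Complex.I_sq

end IsJordanBlock

theorem LinearMap.eigenvalue_eq_ite_of_idempotent {P : H →ₗ[ℂ] H} (hP : P ∘ₗ P = P) {v : H}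
    (hv : v ≠ 0) {μ : ℂ} (h : P v = μ • v) : ∃ b : Bool, μ = if b then 1 else 0 := by
  have h' : (μ * μ - μ) • v = 0 := by
    have := LinearMap.congr_fun hP v
    rw [LinearMap.comp_apply, h, map_smul, h, smul_smul] at this
    rw [sub_smul, this, sub_self]
  have h'' : μ * (μ - 1) = 0 := by
    linear_combination (smul_eq_zero.1 h').resolve_right hv
  rcases mul_eq_zero.1 h'' with h | h
  · exact ⟨false, by simpa using h⟩
  · exact ⟨true, by simpa using sub_eq_zero.1 h⟩

theorem norm_inv_norm_smul {v : H} (hv : v ≠ 0) : ‖((‖v‖ : ℂ)⁻¹) • v‖ = 1 := by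
  simp [norm_smul, hv]

variable {P₀ P₁ : H →ₗ[ℂ] H}

/-- A unit vector in the range of `P₀` that is mapped to a multiple of itself
by `P₀ P₁`, inside a subspace without common eigenvectors, generates a Jordan block. -/
theorem exists_isJordanBlock_of_apply_apply_eq_smul
    (h₁proj : P₁ ∘ₗ P₁ = P₁) (h₁sym : ∀ x y : H, ⟪P₁ x, y⟫ = ⟪x, P₁ y⟫)
    (h₀sym : ∀ x y : H, ⟪P₀ x, y⟫ = ⟪x, P₀ y⟫)
    {W : Submodule ℂ H} (hW₁ : ∀ w ∈ W, P₁ w ∈ W)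
    {a : H} (haW : a ∈ W) (ha : ‖a‖ = 1) (h₀a : P₀ a = a) {κ : ℂ} (hκ : P₀ (P₁ a) = κ • a)
    (hne : ∀ μ : ℂ, P₁ a ≠ μ • a) : ∃ S ≤ W, IsJordanBlock P₀ P₁ S := by
  have hidem : P₁ (P₁ a) = P₁ a := LinearMap.congr_fun h₁proj a
  have haa : ⟪a, a⟫ = 1 := by simp [inner_self_eq_norm_sq_to_K, ha]
  have hP₁a : P₁ a ≠ 0 := by simpa using hne 0
  set x : ℝ := ‖P₁ a‖ with hxdef
  have hx : 0 < x := norm_pos_iff.2 hP₁a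
  have hxC : (x : ℂ) ≠ 0 := by exact_mod_cast hx.ne'
  have hin : ⟪a, P₁ a⟫ = (x : ℂ) ^ 2 := by
    rw [← hidem, ← h₁sym, inner_self_eq_norm_sq_to_K]
    rfl
  have hκx : κ = (x : ℂ) ^ 2 := by
    rw [← hin]
    nth_rw 1 [← h₀a]
    rw [h₀sym, hκ, inner_smul_right, haa, mul_one]
  set d : H := P₁ a - ((x : ℂ) ^ 2) • a with hd
  have hd0 : d ≠ 0 := sub_ne_zero.2 (hne _)
  have had : ⟪a, d⟫ = 0 := by rw [hd, inner_sub_right, inner_smul_right, hin, haa]; ring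
  have hP₀d : P₀ d = 0 := by rw [hd, map_sub, map_smul, hκ, h₀a, hκx, sub_self]
  have hnd : ‖d‖ ^ 2 = x ^ 2 * (1 - x ^ 2) := by
    have h1 : P₁ a = ((x : ℂ) ^ 2) • a + d := by rw [hd]; abel
    have h2 := norm_add_sq_eq_norm_sq_add_norm_sq_of_inner_eq_zero (𝕜 := ℂ) (((x : ℂ) ^ 2) • a) d
      (by rw [inner_smul_left, had, mul_zero])
    rw [← h1, norm_smul, ha, ← hxdef, norm_pow, Complex.norm_real, norm_norm] at h2
    linarith
  have hd' : 0 < ‖d‖ := norm_pos_iff.2 hd0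
  have hdC : (‖d‖ : ℂ) ≠ 0 := by exact_mod_cast hd'.ne'
  have hndC : (‖d‖ : ℂ) ^ 2 = x ^ 2 * (1 - x ^ 2) := by exact_mod_cast hnd
  have hP₁ : P₁ a = (x : ℂ) • ((x : ℂ) • a + ((‖d‖ / x : ℝ) : ℂ) • ((‖d‖ : ℂ)⁻¹ • d)) := by
    have h : (x : ℂ) * ((‖d‖ / x : ℝ) * (‖d‖ : ℂ)⁻¹) = 1 := by
      push_cast
      field_simp
    rw [smul_add, smul_smul, smul_smul, smul_smul, mul_assoc, h, one_smul, ← sq, hd,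
      add_sub_cancel]
  have hP₁d : P₁ d = (1 - (x : ℂ) ^ 2) • P₁ a := by
    rw [hd, map_sub, map_smul, hidem, sub_smul, one_smul]
  refine ⟨Submodule.span ℂ {a, (‖d‖ : ℂ)⁻¹ • d}, ?_, a, (‖d‖ : ℂ)⁻¹ • d, x, ‖d‖ / x, hx,
    by positivity, ?_, ha, norm_inv_norm_smul hd0, by rw [inner_smul_right, had, mul_zero], rfl,
    h₀a, by rw [map_smul, hP₀d, smul_zero], hP₁, ?_⟩
  · rw [Submodule.span_le, Set.pair_subset_iff]
    exact ⟨haW, W.smul_mem _ (W.sub_mem (hW₁ a haW) (W.smul_mem _ haW))⟩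
  · rw [div_pow, hnd]
    field_simp
    ring
  · rw [map_smul, hP₁d, hP₁, smul_smul, smul_smul]
    congr 1
    push_cast
    field_simp
    linear_combination -hndC

/-- A nonzero subspace invariant under `P₀` and `P₁` contains a common eigenvector or a block. -/
theorem exists_common_eigenvector_or_isJordanBlock [FiniteDimensional ℂ H]
    (h₀proj : P₀ ∘ₗ P₀ = P₀) (h₀sym : ∀ x y : H, ⟪P₀ x, y⟫ = ⟪x, P₀ y⟫)
    (h₁proj : P₁ ∘ₗ P₁ = P₁) (h₁sym : ∀ x y : H, ⟪P₁ x, y⟫ = ⟪x, P₁ y⟫)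
    {W : Submodule ℂ H} (hW : W ≠ ⊥) (hW₀ : ∀ w ∈ W, P₀ w ∈ W) (hW₁ : ∀ w ∈ W, P₁ w ∈ W) :
    (∃ v ∈ W, v ≠ 0 ∧ ∃ μ ν : ℂ, P₀ v = μ • v ∧ P₁ v = ν • v) ∨
      ∃ S ≤ W, IsJordanBlock P₀ P₁ S := by
  have hidem₀ : ∀ w, P₀ (P₀ w) = P₀ w := LinearMap.congr_fun h₀proj
  have hidem₁ : ∀ w, P₁ (P₁ w) = P₁ w := LinearMap.congr_fun h₁proj
  have : Nontrivial W := Submodule.nontrivial_iff_ne_bot.2 hW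
  obtain ⟨t, ht⟩ := Module.End.exists_eigenvalue
    ((P₀ + P₁).restrict (fun w hw => W.add_mem (hW₀ w hw) (hW₁ w hw)) : Module.End ℂ W)
  obtain ⟨⟨w, hwW⟩, hw⟩ := ht.exists_hasEigenvector
  have hw0 : w ≠ 0 := by simpa using hw.2
  have hPw : P₁ w = t • w - P₀ w := by
    have h : P₀ w + P₁ w = t • w := congrArg Subtype.val hw.apply_eq_smul
    rw [← h, add_sub_cancel_left]
  by_cases hp : P₀ w = 0
  · exact .inl ⟨w, hwW, hw0, 0, t, by simp [hp], by simp [hPw, hp]⟩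
  have hPp : P₁ (P₀ w) = (t - 1) • (t • w - P₀ w) := by
    have h := hidem₁ w
    rw [hPw, map_sub, map_smul, hPw] at h
    linear_combination (norm := module) -h
  set a : H := (‖P₀ w‖ : ℂ)⁻¹ • P₀ w with ha_def
  have h₀a : P₀ a = a := by rw [ha_def, map_smul, hidem₀]
  have haW : a ∈ W := W.smul_mem _ (hW₀ w hwW)
  have ha : ‖a‖ = 1 := norm_inv_norm_smul hp
  by_cases hex : ∃ μ : ℂ, P₁ a = μ • a
  · obtain ⟨μ, hμ⟩ := hex
    exact .inl ⟨a, haW, norm_ne_zero_iff.1 (by simp [ha]), 1, μ, by simp [h₀a], hμ⟩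
  · refine .inr (exists_isJordanBlock_of_apply_apply_eq_smul h₁proj h₁sym h₀sym hW₁ haW ha h₀a
      (κ := (t - 1) * (t - 1)) ?_ (not_exists.1 hex))
    rw [ha_def, map_smul, hPp]
    simp only [map_smul, map_sub, hidem₀]
    module

theorem apply_mem_inf_orthogonal {P : H →ₗ[ℂ] H} (hsym : ∀ x y : H, ⟪P x, y⟫ = ⟪x, P y⟫)
    {T W : Submodule ℂ H} (hT : ∀ t ∈ T, P t ∈ T) (hW : ∀ w ∈ W, P w ∈ W) :
    ∀ w ∈ Tᗮ ⊓ W, P w ∈ Tᗮ ⊓ W := by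
  rintro w ⟨hwT, hwW⟩
  exact ⟨(Submodule.mem_orthogonal _ _).2 fun u hu =>
    by rw [← hsym]; exact (Submodule.mem_orthogonal _ _).1 hwT _ (hT u hu), hW w hwW⟩

theorem iSup_fin_cons {α : Type*} [CompleteLattice α] {n : ℕ} (x : α) (f : Fin n → α) :
    ⨆ i, (Fin.cons x f : Fin (n + 1) → α) i = x ⊔ ⨆ i, f i :=
  le_antisymm
    (iSup_le (Fin.cases (by simp) fun i => by
      rw [Fin.cons_succ]; exact le_sup_of_le_right (le_iSup f i)))
    (sup_le (le_iSup_of_le 0 (by simp)) (iSup_le fun i => le_iSup_of_le i.succ (by simp)))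

namespace HasJordanDecomposition

variable [FiniteDimensional ℂ H] {W : Submodule ℂ H}

theorem of_isJordanBlock {T : Submodule ℂ H} (hTW : T ≤ W) (hT : IsJordanBlock P₀ P₁ T)
    (h : HasJordanDecomposition P₀ P₁ (Tᗮ ⊓ W)) : HasJordanDecomposition P₀ P₁ W := by
  obtain ⟨ℓ, r, S, v, b, c, hcard, hS, hv, hSS, hSv, hsup, hb, hc⟩ := h
  have hSle : ∀ j, ∀ s ∈ S j, s ∈ Tᗮ := fun j s hs =>
    (hsup.le ((le_iSup S j).trans le_sup_left hs)).1
  have hvle : ∀ i, v i ∈ Tᗮ := fun i =>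
    (hsup.le ((le_iSup (fun i => Submodule.span ℂ {v i}) i).trans le_sup_right
      (Submodule.mem_span_singleton_self _))).1
  refine ⟨ℓ + 1, r, Fin.cons T S, v, b, c, ?_, Fin.cases hT hS, hv, ?_, ?_, ?_, hb, hc⟩
  · have := Submodule.finrank_add_inf_finrank_orthogonal hTW
    rw [hT.finrank_eq_two] at this
    omega
  · refine Fin.cases (Fin.cases (by simp) fun j' _ x hx y hy => ?_)
      fun j => Fin.cases (fun _ x hx y hy => ?_) fun j' hjj' => ?_
    · exact (Submodule.mem_orthogonal _ _).1 (hSle j' y hy) x hx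
    · exact (Submodule.mem_orthogonal' _ _).1 (hSle j x hx) y hy
    · exact hSS j j' (fun h => hjj' (congrArg Fin.succ h))
  · exact Fin.cases (fun i x hx => (Submodule.mem_orthogonal _ _).1 (hvle i) x hx) hSv
  · rw [iSup_fin_cons, sup_assoc, hsup, Submodule.sup_orthogonal_inf_of_hasOrthogonalProjection hTW]

theorem of_common_eigenvector {u : H} (huW : u ∈ W) (hu : ‖u‖ = 1) {b₀ c₀ : Bool}
    (h₀ : P₀ u = (if b₀ then (1 : ℂ) else 0) • u) (h₁ : P₁ u = (if c₀ then (1 : ℂ) else 0) • u)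
    (h : HasJordanDecomposition P₀ P₁ ((Submodule.span ℂ {u})ᗮ ⊓ W)) :
    HasJordanDecomposition P₀ P₁ W := by
  obtain ⟨ℓ, r, S, v, b, c, hcard, hS, hv, hSS, hSv, hsup, hb, hc⟩ := h
  have huW' : Submodule.span ℂ {u} ≤ W := (Submodule.span_singleton_le_iff_mem _ _).2 huW
  have hSle : ∀ j, ∀ s ∈ S j, ⟪s, u⟫ = 0 := fun j s hs =>
    (Submodule.mem_orthogonal_singleton_iff_inner_left).1
      (hsup.le ((le_iSup S j).trans le_sup_left hs)).1
  have hvle : ∀ i, ⟪u, v i⟫ = 0 := fun i =>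
    (Submodule.mem_orthogonal_singleton_iff_inner_right).1
      (hsup.le ((le_iSup (fun i => Submodule.span ℂ {v i}) i).trans le_sup_right
        (Submodule.mem_span_singleton_self _))).1
  have hu0 : u ≠ 0 := norm_ne_zero_iff.1 (by simp [hu])
  refine ⟨ℓ, r + 1, S, Fin.cons u v, Fin.cons b₀ b, Fin.cons c₀ c, ?_, hS, ⟨?_, ?_⟩, hSS, ?_, ?_,
    Fin.cases h₀ hb, Fin.cases h₁ hc⟩
  · have := Submodule.finrank_add_inf_finrank_orthogonal huW'
    rw [finrank_span_singleton hu0] at this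
    omega
  · exact Fin.cases hu hv.1
  · refine Fin.cases (Fin.cases (by simp) fun i _ => hvle i)
      fun i => Fin.cases (fun _ => inner_eq_zero_symm.1 (hvle i)) fun i' hii' => ?_
    exact hv.2 fun h => hii' (congrArg Fin.succ h)
  · exact fun j => Fin.cases (hSle j) (hSv j)
  · have : (fun i => Submodule.span ℂ {(Fin.cons u v : Fin (r + 1) → H) i}) =
        Fin.cons (Submodule.span ℂ {u}) fun i => Submodule.span ℂ {v i} :=
      funext (Fin.cases rfl fun i => rfl)
    rw [this, iSup_fin_cons, sup_left_comm, hsup,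
      Submodule.sup_orthogonal_inf_of_hasOrthogonalProjection huW']

theorem of_invariant
    (h₀proj : P₀ ∘ₗ P₀ = P₀) (h₀sym : ∀ x y : H, ⟪P₀ x, y⟫ = ⟪x, P₀ y⟫)
    (h₁proj : P₁ ∘ₗ P₁ = P₁) (h₁sym : ∀ x y : H, ⟪P₁ x, y⟫ = ⟪x, P₁ y⟫)
    (W : Submodule ℂ H) (hW₀ : ∀ w ∈ W, P₀ w ∈ W) (hW₁ : ∀ w ∈ W, P₁ w ∈ W) :
    HasJordanDecomposition P₀ P₁ W := by
  induction hn : Module.finrank ℂ W using Nat.strong_induction_on generalizing W with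
  | _ n ih =>
  have step : ∀ T ≤ W, 0 < Module.finrank ℂ T → (∀ t ∈ T, P₀ t ∈ T) → (∀ t ∈ T, P₁ t ∈ T) →
      HasJordanDecomposition P₀ P₁ (Tᗮ ⊓ W) := by
    intro T hTW hT hT₀ hT₁
    have := Submodule.finrank_add_inf_finrank_orthogonal hTW
    exact ih _ (by omega) _ (apply_mem_inf_orthogonal h₀sym hT₀ hW₀)
      (apply_mem_inf_orthogonal h₁sym hT₁ hW₁) rfl
  rcases eq_or_ne W ⊥ with rfl | hW
  · exact ⟨0, 0, Fin.elim0, Fin.elim0, Fin.elim0, Fin.elim0, by simp, by simp,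
      ⟨fun i => i.elim0, fun i => i.elim0⟩, by simp, by simp, by simp, by simp, by simp⟩
  rcases exists_common_eigenvector_or_isJordanBlock h₀proj h₀sym h₁proj h₁sym hW hW₀ hW₁ with
    ⟨v, hvW, hv, μ, ν, hμ, hν⟩ | ⟨T, hTW, hT⟩
  · obtain ⟨b, rfl⟩ := LinearMap.eigenvalue_eq_ite_of_idempotent h₀proj hv hμ
    obtain ⟨c, rfl⟩ := LinearMap.eigenvalue_eq_ite_of_idempotent h₁proj hv hν
    have hu := norm_inv_norm_smul hv
    set u : H := (‖v‖ : ℂ)⁻¹ • v with hu_def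
    have hu0 : u ≠ 0 := norm_ne_zero_iff.1 (by simp [hu])
    have huW : u ∈ W := W.smul_mem _ hvW
    have h₀ : P₀ u = (if b then (1 : ℂ) else 0) • u := by rw [hu_def, map_smul, hμ, smul_comm]
    have h₁ : P₁ u = (if c then (1 : ℂ) else 0) • u := by rw [hu_def, map_smul, hν, smul_comm]
    have hinv : ∀ (P : H →ₗ[ℂ] H) (z : ℂ), P u = z • u →
        ∀ t ∈ Submodule.span ℂ {u}, P t ∈ Submodule.span ℂ {u} := by
      intro P z hP t ht
      obtain ⟨k, rfl⟩ := Submodule.mem_span_singleton.1 ht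
      rw [map_smul, hP, smul_smul]
      exact Submodule.smul_mem _ _ (Submodule.mem_span_singleton_self _)
    exact of_common_eigenvector huW hu h₀ h₁ (step _
      ((Submodule.span_singleton_le_iff_mem _ _).2 huW) (by simp [finrank_span_singleton hu0])
      (hinv P₀ _ h₀) (hinv P₁ _ h₁))
  · exact of_isJordanBlock hTW hT (step T hTW (by simp [hT.finrank_eq_two])
      (fun t ht => (hT.apply_mem t ht).1) fun t ht => (hT.apply_mem t ht).2)

end HasJordanDecomposition

end JordanDecomposition

/-- Jordan's lemma in the Nagaj–Wocjan–Zhang form (the paper's Lemma 3.1). Given two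
orthogonal projections `P₀, P₁` on an `N`-dimensional complex inner product space,
with reflections `R₀ = 2P₀ - I`, `R₁ = 2P₁ - I` and `Q = R₁ R₀`, the space decomposes
into an orthogonal direct sum of `ℓ` two-dimensional subspaces `S j` and `N - 2ℓ`
one-dimensional subspaces spanned by (orthonormal) vectors `v i` labelled by bits
`(b i, c i)`, satisfying the stated properties. -/
theorem jordan_lemma_NWZ
    {H : Type*} [NormedAddCommGroup H] [InnerProductSpace ℂ H]
    [FiniteDimensional ℂ H] (N : ℕ) (hN : Module.finrank ℂ H = N)
    (P₀ P₁ : H →ₗ[ℂ] H)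
    (h₀proj : P₀ ∘ₗ P₀ = P₀) (h₀sym : ∀ x y : H, ⟪P₀ x, y⟫ = ⟪x, P₀ y⟫)
    (h₁proj : P₁ ∘ₗ P₁ = P₁) (h₁sym : ∀ x y : H, ⟪P₁ x, y⟫ = ⟪x, P₁ y⟫)
    (R₀ R₁ Q : H →ₗ[ℂ] H)
    (hR₀ : R₀ = (2 : ℂ) • P₀ - LinearMap.id)
    (hR₁ : R₁ = (2 : ℂ) • P₁ - LinearMap.id)
    (hQ : Q = R₁ ∘ₗ R₀) :
    ∃ (ℓ r : ℕ) (S : Fin ℓ → Submodule ℂ H) (v : Fin r → H) (b c : Fin r → Bool),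
      -- there are `ℓ` two-dimensional pieces and `N - 2ℓ` one-dimensional pieces
      2 * ℓ + r = N ∧
      (∀ j, Module.finrank ℂ (S j) = 2) ∧
      -- the one-dimensional subspaces `T_i^{(b c)} = span {v i}` are pairwise orthogonal
      Orthonormal ℂ v ∧
      -- all the pieces are pairwise orthogonal and together span the whole space
      (∀ j j', j ≠ j' → ∀ x ∈ S j, ∀ y ∈ S j', ⟪x, y⟫ = 0) ∧
      (∀ j i, ∀ x ∈ S j, ⟪x, v i⟫ = 0) ∧
      ((⨆ j, S j) ⊔ (⨆ i, Submodule.span ℂ {v i}) = ⊤) ∧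
      -- property (2): each one-dimensional piece is spanned by a vector with
      -- `P₀ v = b • v` and `P₁ v = c • v`
      (∀ i, P₀ (v i) = (if b i then (1 : ℂ) else 0) • v i) ∧
      (∀ i, P₁ (v i) = (if c i then (1 : ℂ) else 0) • v i) ∧
      -- property (1): the structure of each two-dimensional piece
      (∀ j, ∃ (a ap be bep : H) (θ : ℝ),
        a ∈ S j ∧ ap ∈ S j ∧ be ∈ S j ∧ bep ∈ S j ∧
        ‖a‖ = 1 ∧ ‖ap‖ = 1 ∧ ⟪a, ap⟫ = 0 ∧
        ‖be‖ = 1 ∧ ‖bep‖ = 1 ∧ ⟪be, bep⟫ = 0 ∧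
        Submodule.span ℂ ({a, ap} : Set H) = S j ∧
        Submodule.span ℂ ({be, bep} : Set H) = S j ∧
        (0 : ℝ) < (⟪a, be⟫).re ∧ (⟪a, be⟫).im = 0 ∧
        (∀ s ∈ S j, P₀ s = ⟪a, s⟫ • a) ∧
        (∀ s ∈ S j, P₁ s = ⟪be, s⟫ • be) ∧
        (∀ s ∈ S j, Q s ∈ S j) ∧
        θ = 2 * Real.arccos (⟪a, be⟫).re ∧
        Q ((Real.sqrt 2 : ℂ)⁻¹ • (a - Complex.I • ap)) =
          Complex.exp ((θ : ℂ) * Complex.I) • ((Real.sqrt 2 : ℂ)⁻¹ • (a - Complex.I • ap)) ∧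
        Q ((Real.sqrt 2 : ℂ)⁻¹ • (a + Complex.I • ap)) =
          Complex.exp (-(θ : ℂ) * Complex.I) • ((Real.sqrt 2 : ℂ)⁻¹ • (a + Complex.I • ap))) := by
  obtain ⟨ℓ, r, S, v, b, c, hcard, hS, hv, hSS, hSv, hsup, hb, hc⟩ :=
    HasJordanDecomposition.of_invariant h₀proj h₀sym h₁proj h₁sym ⊤ (by simp) (by simp)
  exact ⟨ℓ, r, S, v, b, c, by rw [hcard, finrank_top, hN], fun j => (hS j).finrank_eq_two, hv, hSS,
    hSv, hsup, hb, hc, fun j => (hS j).exists_bases hR₀ hR₁ hQ⟩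
end

section
/- Let H be a complex inner product space, Π an orthogonal projection on H, γ ≥ 0, and (α_j)_{j∈J} a finite orthonormal family in H such that the vectors Π α_j are pairwise orthogonal and ‖Π α_j‖² ≤ γ for every j ∈ J. Then for every vector ψ = ∑_{j∈J} d_j α_j with coefficients d_j ∈ ℂ, one has ‖Π ψ‖² ≤ γ ‖ψ‖²; consequently, for every e ∈ H, ‖Π(ψ + e)‖ ≤ √γ · ‖ψ‖ + ‖e‖. -/
open scoped ComplexInnerProductSpace

/-- Pythagoras' theorem for a linear combination of pairwise orthogonal vectors. -/
lemma norm_sq_sum_smul_of_pairwise_orthogonal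
    {H : Type*} [NormedAddCommGroup H] [InnerProductSpace ℂ H] {J : Type*} [Fintype J]
    (v : J → H) (hv : ∀ j j', j ≠ j' → ⟪v j, v j'⟫ = 0) (d : J → ℂ) :
    ‖∑ j, d j • v j‖ ^ 2 = ∑ j, ‖d j‖ ^ 2 * ‖v j‖ ^ 2 := by
  rw [← Complex.ofReal_inj, Complex.ofReal_pow]
  have h := inner_self_eq_norm_sq_to_K (𝕜 := ℂ) (∑ j, d j • v j)
  refine h.symm.trans ?_
  rw [sum_inner, Complex.ofReal_sum]
  refine Finset.sum_congr rfl fun j _ => ?_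
  rw [inner_sum, Finset.sum_eq_single j]
  · rw [inner_self_eq_norm_sq_to_K, norm_smul, ← mul_pow]
    exact (Complex.ofReal_pow _ _).symm
  · intro k _ hk
    rw [inner_smul_left, inner_smul_right, hv j k hk.symm, mul_zero, mul_zero]
  · simp

/-- An orthogonal projection does not increase norms. -/
lemma norm_apply_le_of_symmetric_idempotent
    {H : Type*} [NormedAddCommGroup H] [InnerProductSpace ℂ H] (P : H →ₗ[ℂ] H)
    (hproj : P ∘ₗ P = P) (hsym : ∀ x y : H, ⟪P x, y⟫ = ⟪x, P y⟫) (x : H) :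
    ‖P x‖ ≤ ‖x‖ := by
  have hinner : ⟪P x, P x⟫ = ⟪x, P x⟫ := by
    rw [hsym, ← LinearMap.comp_apply, hproj]
  have hmul : ‖P x‖ * ‖P x‖ ≤ ‖x‖ * ‖P x‖ := by
    rw [← inner_self_eq_norm_mul_norm (𝕜 := ℂ), hinner]
    exact re_inner_le_norm x (P x)
  rcases (norm_nonneg (P x)).eq_or_lt with h0 | hpos
  · rw [← h0]
    exact norm_nonneg x
  · exact le_of_mul_le_mul_right hmul hpos

/-- The computation underlying the fourth claim of the paper's Lemma 3.2: if `ψ` is a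
linear combination of an orthonormal family `α j` whose images `P (α j)` under an
orthogonal projection `P` are pairwise orthogonal and satisfy `‖P (α j)‖² ≤ γ`, then
`‖P ψ‖² ≤ γ ‖ψ‖²`, and consequently `‖P (ψ + e)‖ ≤ √γ ‖ψ‖ + ‖e‖` for every error
vector `e`. -/
theorem proj_le_of_small_eigenvalues
    {H : Type*} [NormedAddCommGroup H] [InnerProductSpace ℂ H]
    (γ : ℝ) (hγ : 0 ≤ γ)
    {J : Type*} [Fintype J] (α : J → H) (hα : Orthonormal ℂ α)
    (P : H →ₗ[ℂ] H)
    (hproj : P ∘ₗ P = P)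
    (hsym : ∀ x y : H, ⟪P x, y⟫ = ⟪x, P y⟫)
    (horth : ∀ j j', j ≠ j' → ⟪P (α j), P (α j')⟫ = 0)
    (hlow : ∀ j, ‖P (α j)‖ ^ 2 ≤ γ)
    (d : J → ℂ) (ψ : H) (hψ : ψ = ∑ j, d j • α j) :
    ‖P ψ‖ ^ 2 ≤ γ * ‖ψ‖ ^ 2 ∧
    ∀ e : H, ‖P (ψ + e)‖ ≤ Real.sqrt γ * ‖ψ‖ + ‖e‖ := by
  have hsq : ‖P ψ‖ ^ 2 ≤ γ * ‖ψ‖ ^ 2 := by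
    simp only [hψ, map_sum, map_smul]
    rw [norm_sq_sum_smul_of_pairwise_orthogonal _ horth,
      norm_sq_sum_smul_of_pairwise_orthogonal α fun _ _ h => hα.2 h, Finset.mul_sum]
    refine Finset.sum_le_sum fun j _ => ?_
    rw [hα.1 j, one_pow, mul_one, mul_comm]
    exact mul_le_mul_of_nonneg_right (hlow j) (sq_nonneg _)
  refine ⟨hsq, fun e => ?_⟩
  have hnorm : ‖P ψ‖ ≤ Real.sqrt γ * ‖ψ‖ := by
    refine (sq_le_sq₀ (norm_nonneg _) (by positivity)).1 ?_
    rwa [mul_pow, Real.sq_sqrt hγ]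
  rw [map_add]
  exact (norm_add_le _ _).trans
    (add_le_add hnorm (norm_apply_le_of_symmetric_idempotent P hproj hsym e))
end
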